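/- For any Schrödinger representation S : H(f) → GL(X) of type λ there exists a Weil representation W : G(f) → GL(X) of type λ associated to S. Moreover, the Weil representation of type λ is unique up to equivalence and multiplication by a linear character of G(f): if W₁ and W₂ are Weil representations of type λ, then there is a linear character χ : G(f) → ℂ^× such that W₂ is equivalent to χ·W₁. -/

import Mathlib

namespace Paper

/-- Multiplication of the Heisenberg group `H(φ)` on `C × V`. -/
def hMul {C V : Type*} [AddCommGroup C] [AddCommGroup V] (φ : V → V → C)
    (p q : C × V) : C × V :=
  (p.1 + q.1 + φ p.2 q.2, p.2 + q.2)

/-- Action of an additive automorphism of `V` on the Heisenberg group. -/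
def hAct {C V : Type*} [AddCommGroup V] (g : V ≃+ V) (p : C × V) : C × V := (p.1, g p.2)

/-- `g` preserves the form `φ`. -/
def IsIsometry {C V : Type*} [AddCommGroup V] (φ : V → V → C) (g : V ≃+ V) : Prop :=
  ∀ u v, φ (g u) (g v) = φ u v

/-- `S` is a representation of the Heisenberg group `H(φ)`. -/
def IsRep {C V X : Type*} [AddCommGroup C] [AddCommGroup V] [AddCommGroup X] [Module ℂ X]
    (φ : V → V → C) (S : C × V → X ≃ₗ[ℂ] X) : Prop :=
  ∀ p q, S (hMul φ p q) = S p * S q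

/-- The restriction of `S` to the central subgroup `(C, 0)` is a multiple of `χ`. -/
def LiesOver {C V X : Type*} [AddCommGroup C] [AddCommGroup V] [AddCommGroup X] [Module ℂ X]
    (χ : C → ℂ) (S : C × V → X ≃ₗ[ℂ] X) : Prop :=
  ∀ c : C, (S (c, 0) : X →ₗ[ℂ] X) = χ c • (LinearMap.id : X →ₗ[ℂ] X)

/-- `S` is irreducible. -/
def IsIrred {C V X : Type*} [AddCommGroup C] [AddCommGroup V] [AddCommGroup X] [Module ℂ X]
    (S : C × V → X ≃ₗ[ℂ] X) : Prop :=
  Nontrivial X ∧ ∀ W : Submodule ℂ X, (∀ p, ∀ x ∈ W, S p x ∈ W) → W = ⊥ ∨ W = ⊤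

/-- Equivalence of representations of the Heisenberg group. -/
def AreEquivalent {C V X Y : Type*} [AddCommGroup C] [AddCommGroup V]
    [AddCommGroup X] [Module ℂ X] [AddCommGroup Y] [Module ℂ Y]
    (S₁ : C × V → X ≃ₗ[ℂ] X) (S₂ : C × V → Y ≃ₗ[ℂ] Y) : Prop :=
  ∃ T : X ≃ₗ[ℂ] Y, ∀ p x, T (S₁ p x) = S₂ p (T x)

/-- `S` is equivalent to its conjugate under `g`. -/
def InvariantUnder {C V X : Type*} [AddCommGroup C] [AddCommGroup V]
    [AddCommGroup X] [Module ℂ X] (g : V ≃+ V) (S : C × V → X ≃ₗ[ℂ] X) : Prop :=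
  AreEquivalent S fun p => S (hAct g p)

/-- `S` is a Schrödinger representation of `H(φ)` of type `χ`. -/
def IsSchrodinger {C V X : Type*} [AddCommGroup C] [AddCommGroup V]
    [AddCommGroup X] [Module ℂ X] (φ : V → V → C) (χ : C → ℂ)
    (S : C × V → X ≃ₗ[ℂ] X) : Prop :=
  IsRep φ S ∧ IsIrred S ∧ LiesOver χ S ∧
    ∀ g : V ≃+ V, IsIsometry φ g → InvariantUnder g S

/-- `W` is a Weil representation (on the class `P` of isometries) associated to
the Schrödinger representation `S`. -/
def IsWeilOn {C V X : Type*} [AddCommGroup C] [AddCommGroup V]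
    [AddCommGroup X] [Module ℂ X] (φ : V → V → C) (P : (V ≃+ V) → Prop)
    (S : C × V → X ≃ₗ[ℂ] X) (W : (V ≃+ V) → X ≃ₗ[ℂ] X) : Prop :=
  (∀ g g', P g → P g' → W (g.trans g') = W g' * W g) ∧
  (∀ g, P g → ∀ p x, W g (S p x) = S (hAct g p) (W g x))

/-- The central involution `v ↦ -v` of `V`. -/
def negAuto (V : Type*) [AddCommGroup V] : V ≃+ V :=
  AddEquiv.mk' (Equiv.neg V) (by intro a b; show -(a + b) = -a + -b; abel)



section Form

variable {C V : Type*} [AddCommGroup C] [AddCommGroup V]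

/-- Biadditivity of a form. -/
structure IsBiadditive (φ : V → V → C) : Prop where
  add_left : ∀ u v w, φ (u + v) w = φ u w + φ v w
  add_right : ∀ u v w, φ u (v + w) = φ u v + φ u w

namespace IsBiadditive

variable {φ : V → V → C}

theorem zero_left (hφ : IsBiadditive φ) (v : V) : φ 0 v = 0 := by
  simpa using hφ.add_left 0 0 v

theorem zero_right (hφ : IsBiadditive φ) (v : V) : φ v 0 = 0 := by
  simpa using hφ.add_right v 0 0

theorem neg_left (hφ : IsBiadditive φ) (u v : V) : φ (-u) v = -φ u v := by
  have h := hφ.add_left (-u) u v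
  rw [neg_add_cancel, hφ.zero_left] at h
  exact eq_neg_of_add_eq_zero_left h.symm

theorem neg_right (hφ : IsBiadditive φ) (u v : V) : φ u (-v) = -φ u v := by
  have h := hφ.add_right u (-v) v
  rw [neg_add_cancel, hφ.zero_right] at h
  exact eq_neg_of_add_eq_zero_left h.symm

end IsBiadditive

theorem isIsometry_negAuto {φ : V → V → C} (hφ : IsBiadditive φ) :
    IsIsometry φ (negAuto V) := fun u v => by
  change φ (-u) (-v) = φ u v
  rw [hφ.neg_left, hφ.neg_right, neg_neg]

omit [AddCommGroup C] in
theorem IsIsometry.trans {φ : V → V → C} {g g' : V ≃+ V} (hg : IsIsometry φ g)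
    (hg' : IsIsometry φ g') : IsIsometry φ (g.trans g') := fun u v => by
  rw [AddEquiv.trans_apply, AddEquiv.trans_apply, hg', hg]

/-- Left translation on the Heisenberg group. -/
def hMulLeft {φ : V → V → C} (hφ : IsBiadditive φ) (p : C × V) : C × V ≃ C × V where
  toFun := hMul φ p
  invFun := hMul φ (-p.1 + φ p.2 p.2, -p.2)
  left_inv q := by
    ext <;> simp only [hMul, hφ.add_right, hφ.neg_left] <;> abel
  right_inv q := by
    ext <;> simp only [hMul, hφ.add_right, hφ.neg_left, hφ.neg_right] <;> abel

theorem exists_add_self_eq (hV : Odd (Nat.card V)) (w : V) : ∃ v, v + v = w := by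
  obtain ⟨k, hk⟩ := hV
  refine ⟨(k + 1) • w, ?_⟩
  have h : Nat.card V • w = 0 := card_nsmul_eq_zero'
  rw [hk] at h
  rw [← add_nsmul, show k + 1 + (k + 1) = (2 * k + 1) + 1 by ring, succ_nsmul, h, zero_add]

end Form

section Trace

variable {X Y : Type*} [AddCommGroup X] [Module ℂ X] [AddCommGroup Y] [Module ℂ Y]

theorem trace_eq_sum_repr {ι : Type*} [Fintype ι] (b : Module.Basis ι ℂ X) (f : X →ₗ[ℂ] X) :
    LinearMap.trace ℂ X f = ∑ i, b.repr (f (b i)) i := by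
  classical
  rw [LinearMap.trace_eq_matrix_trace ℂ b, Matrix.trace]
  simp [LinearMap.toMatrix_apply]

/-- The eigenspaces for `1` and `-1` of an involution have dimensions differing by its trace. -/
theorem trace_involution [FiniteDimensional ℂ X] (A : X →ₗ[ℂ] X) (hA : A ∘ₗ A = LinearMap.id) :
    LinearMap.trace ℂ X A =
      Module.finrank ℂ (LinearMap.ker (A - LinearMap.id)) -
        Module.finrank ℂ (LinearMap.ker (A + LinearMap.id)) := by
  have hA' (x : X) : A (A x) = x := LinearMap.congr_fun hA x
  have h₁ : LinearMap.IsProj (LinearMap.ker (A - LinearMap.id))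
      ((1 / 2 : ℂ) • (LinearMap.id + A)) := by
    constructor
    · intro x
      simp [hA', add_comm]
    · intro x hx
      have hx : A x = x := by simpa [sub_eq_zero] using hx
      simp only [LinearMap.smul_apply, LinearMap.add_apply, LinearMap.id_apply, hx]
      module
  have h₂ : LinearMap.IsProj (LinearMap.ker (A + LinearMap.id))
      ((1 / 2 : ℂ) • (LinearMap.id - A)) := by
    constructor
    · intro x
      simp only [LinearMap.mem_ker, LinearMap.add_apply, LinearMap.smul_apply,
        LinearMap.sub_apply, LinearMap.id_apply, map_smul, map_sub, hA']
      module
    · intro x hx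
      have hx : A x = -x := by simpa [add_eq_zero_iff_eq_neg] using hx
      simp only [LinearMap.smul_apply, LinearMap.sub_apply, LinearMap.id_apply, hx]
      module
  rw [← h₁.trace, ← h₂.trace, ← map_sub]
  congr 1
  module

end Trace

section Schur

variable {C V X Y : Type*} [AddCommGroup C] [AddCommGroup V]
  [AddCommGroup X] [Module ℂ X] [AddCommGroup Y] [Module ℂ Y]

theorem IsRep.finiteDimensional [Finite C] [Finite V] {φ : V → V → C}
    {S : C × V → X ≃ₗ[ℂ] X} (hS : IsRep φ S) (hirr : IsIrred S) : FiniteDimensional ℂ X := by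
  obtain ⟨_, hW⟩ := hirr
  obtain ⟨x, hx⟩ := exists_ne (0 : X)
  let W := Submodule.span ℂ (Set.range fun p => S p x)
  have hinv : ∀ p, ∀ y ∈ W, S p y ∈ W := by
    intro p y hy
    have : W ≤ W.comap (S p : X →ₗ[ℂ] X) := by
      refine Submodule.span_le.2 ?_
      rintro _ ⟨q, rfl⟩
      exact Submodule.subset_span ⟨hMul φ p q, by simp [hS p q]⟩
    exact this hy
  have : FiniteDimensional ℂ W := FiniteDimensional.span_of_finite ℂ (Set.finite_range _)
  rcases hW W hinv with h | h
  · have hmem : S 0 x ∈ W := Submodule.subset_span ⟨0, rfl⟩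
    rw [h, Submodule.mem_bot, LinearEquiv.map_eq_zero_iff] at hmem
    exact absurd hmem hx
  · rw [h] at this
    exact Module.Finite.equiv (Submodule.topEquiv (R := ℂ) (M := X))

/-- Schur's lemma: endomorphisms of an irreducible representation are scalars. -/
theorem IsIrred.exists_eq_smul_id [FiniteDimensional ℂ X] {S : C × V → X ≃ₗ[ℂ] X}
    (hirr : IsIrred S) (M : X →ₗ[ℂ] X) (hM : ∀ p x, M (S p x) = S p (M x)) :
    ∃ c : ℂ, M = c • LinearMap.id := by
  obtain ⟨_, hW⟩ := hirr
  obtain ⟨c, hc⟩ := Module.End.exists_eigenvalue M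
  refine ⟨c, ?_⟩
  rcases hW (Module.End.eigenspace M c) (fun p x hx => by
    rw [Module.End.mem_eigenspace_iff] at hx ⊢
    rw [hM, hx, map_smul]) with h | h
  · exact absurd h hc
  · ext x
    have : x ∈ Module.End.eigenspace M c := h ▸ Submodule.mem_top
    simpa [Module.End.mem_eigenspace_iff] using this

/-- Schur's lemma: two invertible intertwiners out of an irreducible representation
are proportional. -/
theorem IsIrred.exists_eq_smul [FiniteDimensional ℂ X] {S : C × V → X ≃ₗ[ℂ] X}
    (hirr : IsIrred S) {S' : C × V → Y ≃ₗ[ℂ] Y} (T U : X ≃ₗ[ℂ] Y)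
    (hT : ∀ p x, T (S p x) = S' p (T x)) (hU : ∀ p x, U (S p x) = S' p (U x)) :
    ∃ c : ℂ, c ≠ 0 ∧ ∀ x, U x = c • T x := by
  obtain ⟨c, hc⟩ := hirr.exists_eq_smul_id (U.trans T.symm : X →ₗ[ℂ] X) (fun p x => by
    apply T.injective
    simp [hT, hU])
  have h (x : X) : U x = c • T x := by
    have := LinearMap.congr_fun hc x
    simp only [LinearEquiv.coe_coe, LinearEquiv.trans_apply, LinearMap.smul_apply,
      LinearMap.id_apply] at this
    rw [← map_smul, ← this, T.apply_symm_apply]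
  refine ⟨c, ?_, h⟩
  rintro rfl
  obtain ⟨_, _⟩ := hirr
  obtain ⟨x, hx⟩ := exists_ne (0 : X)
  exact hx (by simpa using h x)

/-- Schur's lemma: a nonzero intertwiner of irreducible representations is invertible. -/
theorem IsIrred.areEquivalent {S₁ : C × V → X ≃ₗ[ℂ] X} {S₂ : C × V → Y ≃ₗ[ℂ] Y}
    (h₁ : IsIrred S₁) (h₂ : IsIrred S₂) (M : X →ₗ[ℂ] Y)
    (hM : ∀ p x, M (S₁ p x) = S₂ p (M x)) (hM0 : M ≠ 0) : AreEquivalent S₁ S₂ := by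
  have hker : LinearMap.ker M = ⊥ := by
    refine (h₁.2 _ fun p x hx => ?_).resolve_right fun h => hM0 (LinearMap.ker_eq_top.1 h)
    rw [LinearMap.mem_ker] at hx ⊢
    rw [hM, hx, map_zero]
  have hrange : LinearMap.range M = ⊤ := by
    refine (h₂.2 _ ?_).resolve_left fun h => hM0 (LinearMap.range_eq_bot.1 h)
    rintro p _ ⟨x, rfl⟩
    exact ⟨S₁ p x, hM p x⟩
  exact ⟨LinearEquiv.ofBijective M ⟨LinearMap.ker_eq_bot.1 hker, LinearMap.range_eq_top.1 hrange⟩,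
    hM⟩

/-- The average of a linear map over the Heisenberg group. -/
def average [Fintype C] [Fintype V] (S₁ : C × V → X ≃ₗ[ℂ] X) (S₂ : C × V → Y ≃ₗ[ℂ] Y)
    (M : X →ₗ[ℂ] Y) : X →ₗ[ℂ] Y :=
  ∑ p, (S₂ p : Y →ₗ[ℂ] Y) ∘ₗ M ∘ₗ ((S₁ p).symm : X →ₗ[ℂ] X)

omit [AddCommGroup C] [AddCommGroup V] in
theorem average_apply [Fintype C] [Fintype V] (S₁ : C × V → X ≃ₗ[ℂ] X)
    (S₂ : C × V → Y ≃ₗ[ℂ] Y) (M : X →ₗ[ℂ] Y) (x : X) :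
    average S₁ S₂ M x = ∑ p, S₂ p (M ((S₁ p).symm x)) := by
  simp [average, LinearMap.sum_apply]

theorem average_intertwines [Fintype C] [Fintype V] {φ : V → V → C} (hφ : IsBiadditive φ)
    {S₁ : C × V → X ≃ₗ[ℂ] X} {S₂ : C × V → Y ≃ₗ[ℂ] Y} (h₁ : IsRep φ S₁) (h₂ : IsRep φ S₂)
    (M : X →ₗ[ℂ] Y) (p : C × V) (x : X) :
    average S₁ S₂ M (S₁ p x) = S₂ p (average S₁ S₂ M x) := by
  rw [average_apply, average_apply, map_sum, ← (hMulLeft hφ p).sum_comp]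
  refine Finset.sum_congr rfl fun q _ => ?_
  change S₂ (hMul φ p q) (M ((S₁ (hMul φ p q)).symm (S₁ p x))) = _
  have h : (S₁ (hMul φ p q)).symm (S₁ p x) = (S₁ q).symm x := by
    rw [LinearEquiv.symm_apply_eq, h₁, LinearEquiv.mul_apply, LinearEquiv.apply_symm_apply]
  rw [h, h₂, LinearEquiv.mul_apply]

omit [AddCommGroup C] [AddCommGroup V] in
/-- A sum of products of matrix coefficients in terms of averages of rank one maps. -/
theorem sum_trace_mul_trace [Fintype C] [Fintype V] {ι κ : Type*} [Fintype ι] [Fintype κ]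
    (b : Module.Basis ι ℂ X) (b' : Module.Basis κ ℂ Y)
    (S₁ : C × V → X ≃ₗ[ℂ] X) (S₂ : C × V → Y ≃ₗ[ℂ] Y) (A : X →ₗ[ℂ] X) (B : Y →ₗ[ℂ] Y) :
    ∑ p, LinearMap.trace ℂ X (A ∘ₗ ((S₁ p).symm : X →ₗ[ℂ] X)) *
        LinearMap.trace ℂ Y ((S₂ p : Y →ₗ[ℂ] Y) ∘ₗ B) =
      ∑ i, ∑ j, b'.repr
        (average S₁ S₂ ((b.coord i ∘ₗ A).smulRight (B (b' j))) (b i)) j := by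
  simp only [average_apply, map_sum, Finset.sum_apply', trace_eq_sum_repr b, trace_eq_sum_repr b',
    Finset.sum_mul_sum]
  rw [Finset.sum_comm]
  refine Finset.sum_congr rfl fun i _ => ?_
  rw [Finset.sum_comm]
  refine Finset.sum_congr rfl fun j _ => Finset.sum_congr rfl fun p _ => ?_
  simp

theorem average_eq_smul_id [Fintype C] [Fintype V] [FiniteDimensional ℂ X] {φ : V → V → C}
    (hφ : IsBiadditive φ) {S : C × V → X ≃ₗ[ℂ] X} (hS : IsRep φ S) (hirr : IsIrred S)
    (M : X →ₗ[ℂ] X) :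
    average S S M = (Fintype.card (C × V) * LinearMap.trace ℂ X M / Module.finrank ℂ X : ℂ) •
      LinearMap.id := by
  obtain ⟨c, hc⟩ := hirr.exists_eq_smul_id _ (average_intertwines hφ hS hS M)
  rw [hc]
  congr 1
  have _ := hirr.1
  have hn : (Module.finrank ℂ X : ℂ) ≠ 0 := Nat.cast_ne_zero.2 Module.finrank_pos.ne'
  rw [eq_div_iff hn]
  have h := congrArg (LinearMap.trace ℂ X) hc
  have ht (p : C × V) : LinearMap.trace ℂ X
      ((S p : X →ₗ[ℂ] X) ∘ₗ M ∘ₗ ((S p).symm : X →ₗ[ℂ] X)) = LinearMap.trace ℂ X M :=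
    LinearMap.trace_conj' M (S p)
  simp only [average, map_sum, ht, map_smul, LinearMap.trace_id, Finset.sum_const,
    Finset.card_univ, nsmul_eq_mul, smul_eq_mul] at h
  exact h.symm

/-- Schur orthogonality. -/
theorem sum_trace_mul_trace_self [Fintype C] [Fintype V] [FiniteDimensional ℂ X] {φ : V → V → C}
    (hφ : IsBiadditive φ) {S : C × V → X ≃ₗ[ℂ] X} (hS : IsRep φ S) (hirr : IsIrred S)
    (A B : X →ₗ[ℂ] X) :
    ∑ p, LinearMap.trace ℂ X (A ∘ₗ ((S p).symm : X →ₗ[ℂ] X)) *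
        LinearMap.trace ℂ X ((S p : X →ₗ[ℂ] X) ∘ₗ B) =
      Fintype.card (C × V) * LinearMap.trace ℂ X (A ∘ₗ B) / Module.finrank ℂ X := by
  classical
  let b := Module.finBasis ℂ X
  rw [sum_trace_mul_trace b b, trace_eq_sum_repr b (A ∘ₗ B), Finset.mul_sum, Finset.sum_div]
  refine Finset.sum_congr rfl fun i _ => ?_
  rw [Finset.sum_eq_single i]
  · simp [average_eq_smul_id hφ hS hirr, LinearMap.trace_smulRight]
  · intro j _ hj
    simp [average_eq_smul_id hφ hS hirr, hj]
  · simp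

end Schur

section Parity

variable {C V X Y : Type*} [AddCommGroup C] [AddCommGroup V]
  [AddCommGroup X] [Module ℂ X] [AddCommGroup Y] [Module ℂ Y]

/-- `A` is an involution implementing the central involution of `V`. -/
structure IsParity (S : C × V → X ≃ₗ[ℂ] X) (A : X ≃ₗ[ℂ] X) : Prop where
  involutive : ∀ x, A (A x) = x
  intertwines : ∀ p x, A (S p x) = S (p.1, -p.2) (A x)

theorem exists_isParity [FiniteDimensional ℂ X] {S : C × V → X ≃ₗ[ℂ] X} (hirr : IsIrred S)
    (hinv : InvariantUnder (negAuto V) S) : ∃ A, IsParity S A := by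
  obtain ⟨T, hT⟩ := hinv
  replace hT : ∀ p x, T (S p x) = S (p.1, -p.2) (T x) := hT
  obtain ⟨c, hc, h⟩ := hirr.exists_eq_smul (S' := S) (LinearEquiv.refl ℂ X) (T.trans T)
    (fun _ _ => rfl) (fun p x => by simp [hT])
  replace h (x : X) : T (T x) = c • x := h x
  obtain ⟨d, rfl⟩ := IsAlgClosed.exists_eq_mul_self c
  have hd : d ≠ 0 := left_ne_zero_of_mul hc
  refine ⟨T.trans (LinearEquiv.smulOfNeZero ℂ X d⁻¹ (inv_ne_zero hd)), fun x => ?_, fun p x => ?_⟩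
  · simp [h, smul_smul, hd]
  · simp [hT]

variable {φ : V → V → C} {lam : C → ℂ} {S : C × V → X ≃ₗ[ℂ] X} {A : X ≃ₗ[ℂ] X}

theorem LiesOver.central_apply (hover : LiesOver lam S) (c : C) (x : X) :
    S (c, 0) x = lam c • x :=
  LinearMap.congr_fun (hover c) x

theorem IsRep.central_mul_apply (hS : IsRep φ S) (hφ : IsBiadditive φ) (hover : LiesOver lam S)
    (c d : C) (v : V) (x : X) : S (c + d, v) x = lam c • S (d, v) x := by
  have h : hMul φ (c, 0) (d, v) = (c + d, v) := by simp [hMul, hφ.zero_left]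
  rw [← h, hS, LinearEquiv.mul_apply, hover.central_apply]

theorem IsRep.symm_eq (hS : IsRep φ S) (hφ : IsBiadditive φ) (hover : LiesOver lam S)
    (h0 : lam 0 = 1) (p : C × V) : (S p).symm = S (-p.1 + φ p.2 p.2, -p.2) := by
  ext x
  have h : hMul φ p (-p.1 + φ p.2 p.2, -p.2) = (0, 0) := by
    simp [hMul, hφ.neg_right]
  rw [LinearEquiv.symm_apply_eq, ← LinearEquiv.mul_apply, ← hS, h, hover.central_apply, h0,
    one_smul]

theorem IsParity.trace_comp (hA : IsParity S A) (hS : IsRep φ S) (hφ : IsBiadditive φ)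
    (hover : LiesOver lam S) (c : C) (v : V) :
    LinearMap.trace ℂ X ((S (c + 2 • φ v v, v + v) : X →ₗ[ℂ] X) ∘ₗ A) =
      lam c * LinearMap.trace ℂ X A := by
  rw [← LinearMap.trace_conj' (A : X →ₗ[ℂ] X) (S (0, v)), ← smul_eq_mul, ← map_smul]
  congr 1
  ext x
  obtain ⟨y, rfl⟩ := (S (0, v)).surjective x
  have h : hMul φ (2 • φ v v, v + v) (0, -v) = (0, v) := by
    simp only [hMul, hφ.neg_right, hφ.add_left]
    ext <;> simp [two_nsmul]
  simp only [LinearMap.comp_apply, LinearEquiv.coe_coe, LinearMap.smul_apply,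
    LinearEquiv.conj_apply, LinearEquiv.symm_apply_apply]
  rw [hS.central_mul_apply hφ hover, hA.intertwines, ← LinearEquiv.mul_apply (S (2 • φ v v, v + v)),
    ← hS, h]

theorem IsParity.trace_comp_symm [FiniteDimensional ℂ X] (hA : IsParity S A) (hS : IsRep φ S)
    (hφ : IsBiadditive φ) (hover : LiesOver lam S) (h0 : lam 0 = 1) (c : C) (v : V) :
    LinearMap.trace ℂ X ((A : X →ₗ[ℂ] X) ∘ₗ ((S (c + 2 • φ v v, v + v)).symm : X →ₗ[ℂ] X)) =
      lam (-c) * LinearMap.trace ℂ X A := by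
  rw [hS.symm_eq hφ hover h0, LinearMap.trace_comp_comm', ← hA.trace_comp hS hφ hover (-c) (-v)]
  congr 4
  ext
  · simp only [hφ.add_left, hφ.add_right, hφ.neg_left, hφ.neg_right]
    abel
  · simp only
    abel

theorem IsParity.trace_mul_trace [FiniteDimensional ℂ X] (hV : Odd (Nat.card V))
    (hφ : IsBiadditive φ) (hmul : ∀ r s, lam (r + s) = lam r * lam s) (h0 : lam 0 = 1)
    (hA : IsParity S A) (hS : IsRep φ S) (hover : LiesOver lam S)
    {S' : C × V → Y ≃ₗ[ℂ] Y} {B : Y ≃ₗ[ℂ] Y} (hB : IsParity S' B) (hS' : IsRep φ S')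
    (hover' : LiesOver lam S') (p : C × V) :
    LinearMap.trace ℂ X ((A : X →ₗ[ℂ] X) ∘ₗ ((S p).symm : X →ₗ[ℂ] X)) *
        LinearMap.trace ℂ Y ((S' p : Y →ₗ[ℂ] Y) ∘ₗ B) =
      LinearMap.trace ℂ X A * LinearMap.trace ℂ Y B := by
  obtain ⟨r, w⟩ := p
  obtain ⟨v, rfl⟩ := exists_add_self_eq hV w
  obtain ⟨c, rfl⟩ : ∃ c, r = c + 2 • φ v v := ⟨r - 2 • φ v v, by abel⟩
  rw [hA.trace_comp_symm hS hφ hover h0, hB.trace_comp hS' hφ hover', mul_mul_mul_comm, ← hmul,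
    neg_add_cancel, h0, one_mul]

theorem IsParity.trace_sq [Finite C] [Finite V] [FiniteDimensional ℂ X] (hV : Odd (Nat.card V))
    (hφ : IsBiadditive φ) (hmul : ∀ r s, lam (r + s) = lam r * lam s) (h0 : lam 0 = 1)
    (hA : IsParity S A) (hS : IsRep φ S) (hirr : IsIrred S) (hover : LiesOver lam S) :
    LinearMap.trace ℂ X A * LinearMap.trace ℂ X A = 1 := by
  have := Fintype.ofFinite C
  have := Fintype.ofFinite V
  have _ := hirr.1
  have h := sum_trace_mul_trace_self hφ hS hirr (A : X →ₗ[ℂ] X) A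
  have hAA : (A : X →ₗ[ℂ] X) ∘ₗ A = LinearMap.id := LinearMap.ext hA.involutive
  have hn : (Module.finrank ℂ X : ℂ) ≠ 0 := Nat.cast_ne_zero.2 Module.finrank_pos.ne'
  have hcard : (Fintype.card (C × V) : ℂ) ≠ 0 := Nat.cast_ne_zero.2 Fintype.card_ne_zero
  simp only [hA.trace_mul_trace hV hφ hmul h0 hS hover hA hS hover, hAA, LinearMap.trace_id,
    Finset.sum_const, Finset.card_univ, nsmul_eq_mul, mul_div_assoc, div_self hn] at h
  exact mul_left_cancel₀ hcard h

omit [AddCommGroup C] in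
theorem IsParity.neg (hA : IsParity S A) : IsParity S (A.trans (LinearEquiv.neg ℂ)) where
  involutive x := by simp [hA.involutive]
  intertwines p x := by simp [hA.intertwines]

theorem IsSchrodinger.exists_isParity_trace_eq_one [Finite C] [Finite V]
    (hV : Odd (Nat.card V)) (hφ : IsBiadditive φ)
    (hmul : ∀ r s, lam (r + s) = lam r * lam s) (h0 : lam 0 = 1) (h : IsSchrodinger φ lam S) :
    ∃ A, IsParity S A ∧ LinearMap.trace ℂ X A = 1 := by
  obtain ⟨hS, hirr, hover, hinv⟩ := h
  have := hS.finiteDimensional hirr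
  obtain ⟨A, hA⟩ := exists_isParity hirr (hinv _ (isIsometry_negAuto hφ))
  rcases mul_self_eq_one_iff.1 (hA.trace_sq hV hφ hmul h0 hS hirr hover) with h | h
  · exact ⟨A, hA, h⟩
  · refine ⟨_, hA.neg, ?_⟩
    have : ((A.trans (LinearEquiv.neg ℂ) : X ≃ₗ[ℂ] X) : X →ₗ[ℂ] X) = -(A : X →ₗ[ℂ] X) := by
      ext; simp
    rw [this, map_neg, h, neg_neg]

/-- The Schrödinger representation of a given type is unique up to equivalence. -/
theorem IsSchrodinger.areEquivalent [Finite C] [Finite V]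
    (hV : Odd (Nat.card V)) (hφ : IsBiadditive φ)
    (hmul : ∀ r s, lam (r + s) = lam r * lam s) (h0 : lam 0 = 1) (h : IsSchrodinger φ lam S)
    {S' : C × V → Y ≃ₗ[ℂ] Y} (h' : IsSchrodinger φ lam S') : AreEquivalent S S' := by
  have := Fintype.ofFinite C
  have := Fintype.ofFinite V
  have := h.1.finiteDimensional h.2.1
  have := h'.1.finiteDimensional h'.2.1
  obtain ⟨A, hA, hA1⟩ := h.exists_isParity_trace_eq_one hV hφ hmul h0
  obtain ⟨B, hB, hB1⟩ := h'.exists_isParity_trace_eq_one hV hφ hmul h0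
  by_contra hne
  have havg (M : X →ₗ[ℂ] Y) : average S S' M = 0 := by
    by_contra hM
    exact hne (h.2.1.areEquivalent h'.2.1 _ (average_intertwines hφ h.1 h'.1 M) hM)
  have hsum := sum_trace_mul_trace (Module.finBasis ℂ X) (Module.finBasis ℂ Y) S S'
    (A : X →ₗ[ℂ] X) B
  simp only [hA.trace_mul_trace hV hφ hmul h0 h.1 h.2.2.1 hB h'.1 h'.2.2.1, hA1, hB1, havg] at hsum
  simp at hsum

end Parity

section Normalization

variable {C V X : Type*} [AddCommGroup C] [AddCommGroup V] [AddCommGroup X] [Module ℂ X]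

/-- The subspace `p` is stable under `U`, which acts on it with determinant `d`. -/
def HasDetOn (p : Submodule ℂ X) (U : X →ₗ[ℂ] X) (d : ℂ) : Prop :=
  ∃ h : ∀ x ∈ p, U x ∈ p, LinearMap.det (U.restrict h) = d

variable {p : Submodule ℂ X} {U U' : X →ₗ[ℂ] X} {d d' : ℂ}

theorem HasDetOn.unique (h : HasDetOn p U d) (h' : HasDetOn p U d') : d = d' :=
  h.2.symm.trans h'.2

theorem HasDetOn.comp (h : HasDetOn p U d) (h' : HasDetOn p U' d') :
    HasDetOn p (U ∘ₗ U') (d * d') := by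
  obtain ⟨h, rfl⟩ := h
  obtain ⟨h', rfl⟩ := h'
  refine ⟨fun x hx => h _ (h' x hx), ?_⟩
  rw [← LinearMap.det_comp]
  rfl

theorem HasDetOn.smul (h : HasDetOn p U d) (c : ℂ) :
    HasDetOn p (c • U) (c ^ Module.finrank ℂ p * d) := by
  obtain ⟨h, rfl⟩ := h
  refine ⟨fun x hx => p.smul_mem c (h x hx), ?_⟩
  rw [← LinearMap.det_smul]
  rfl

theorem exists_hasDetOn {U : X ≃ₗ[ℂ] X} (h : ∀ x ∈ p, U x ∈ p) :
    ∃ d, d ≠ 0 ∧ HasDetOn p (U : X →ₗ[ℂ] X) d := by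
  refine ⟨_, fun hd => ?_, h, rfl⟩
  refine (LinearMap.bot_lt_ker_of_det_eq_zero hd).ne' (LinearMap.ker_eq_bot.2 fun x y hxy => ?_)
  exact Subtype.ext (U.injective (congrArg Subtype.val hxy))

/-- `U` has equal determinants on the two eigenspaces of the parity operator `A`. -/
def IsBalanced (A U : X →ₗ[ℂ] X) : Prop :=
  ∃ d, d ≠ 0 ∧ HasDetOn (LinearMap.ker (A - LinearMap.id)) U d ∧
    HasDetOn (LinearMap.ker (A + LinearMap.id)) U d

theorem IsBalanced.comp {A : X →ₗ[ℂ] X} (h : IsBalanced A U) (h' : IsBalanced A U') :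
    IsBalanced A (U ∘ₗ U') := by
  obtain ⟨d, hd, h₁, h₂⟩ := h
  obtain ⟨d', hd', h₁', h₂'⟩ := h'
  exact ⟨d * d', mul_ne_zero hd hd', h₁.comp h₁', h₂.comp h₂'⟩

variable {S : C × V → X ≃ₗ[ℂ] X} {A : X ≃ₗ[ℂ] X}

omit [AddCommGroup C] in
theorem IsParity.finrank_eq [FiniteDimensional ℂ X] (hA : IsParity S A)
    (htr : LinearMap.trace ℂ X A = 1) :
    Module.finrank ℂ (LinearMap.ker ((A : X →ₗ[ℂ] X) - LinearMap.id)) =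
      Module.finrank ℂ (LinearMap.ker ((A : X →ₗ[ℂ] X) + LinearMap.id)) + 1 := by
  have h := trace_involution (A : X →ₗ[ℂ] X) (LinearMap.ext hA.involutive)
  rw [htr, eq_sub_iff_add_eq, add_comm] at h
  exact_mod_cast h.symm

omit [AddCommGroup C] in
theorem IsBalanced.eq_one_of_smul [FiniteDimensional ℂ X] (hA : IsParity S A)
    (htr : LinearMap.trace ℂ X A = 1) {c : ℂ} (hc : c ≠ 0) (h : IsBalanced (A : X →ₗ[ℂ] X) U)
    (h' : IsBalanced (A : X →ₗ[ℂ] X) (c • U)) : c = 1 := by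
  obtain ⟨d, hd, h₁, h₂⟩ := h
  obtain ⟨d', -, h₁', h₂'⟩ := h'
  have e := ((h₁.smul c).unique h₁').trans ((h₂.smul c).unique h₂').symm
  rw [hA.finrank_eq htr, pow_succ] at e
  have := mul_right_cancel₀ hd e
  exact mul_left_cancel₀ (pow_ne_zero _ hc) (this.trans (mul_one _).symm)

/-- An operator implementing an automorphism of `V` commutes with the parity operator. -/
theorem IsParity.commute [FiniteDimensional ℂ X] (hA : IsParity S A)
    (htr : LinearMap.trace ℂ X A = 1) (hirr : IsIrred S) {g : V ≃+ V} {U : X ≃ₗ[ℂ] X}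
    (hU : ∀ p x, U (S p x) = S (hAct g p) (U x)) (x : X) : A (U x) = U (A x) := by
  have hUs (p : C × V) (x : X) : U.symm (S (hAct g p) x) = S p (U.symm x) := by
    rw [LinearEquiv.symm_apply_eq, hU, LinearEquiv.apply_symm_apply]
  obtain ⟨c, -, h⟩ := hirr.exists_eq_smul (S' := fun p => S (p.1, -p.2)) A
    ((U.trans A).trans U.symm) hA.intertwines (fun p x => by
      have e : ((hAct g p).1, -(hAct g p).2) = hAct g (p.1, -p.2) := by simp [hAct]
      simp only [LinearEquiv.trans_apply, hU, hA.intertwines]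
      rw [e, hUs])
  have hc : c = 1 := by
    have e : U.symm.conj (A : X →ₗ[ℂ] X) = c • (A : X →ₗ[ℂ] X) := by
      ext y
      simpa [LinearEquiv.conj_apply] using h y
    simpa [LinearMap.trace_conj', htr] using (congrArg (LinearMap.trace ℂ X) e).symm
  have := h x
  rwa [hc, one_smul, LinearEquiv.trans_apply, LinearEquiv.trans_apply,
    LinearEquiv.symm_apply_eq] at this

omit [AddCommGroup C] in
/-- Every invertible operator commuting with the parity operator can be rescaled so as to have
equal determinants on the two eigenspaces. -/
theorem IsParity.exists_isBalanced [FiniteDimensional ℂ X] (hA : IsParity S A)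
    (htr : LinearMap.trace ℂ X A = 1) {U : X ≃ₗ[ℂ] X} (hU : ∀ x, A (U x) = U (A x)) :
    ∃ c : ℂ, c ≠ 0 ∧ IsBalanced (A : X →ₗ[ℂ] X) (c • (U : X →ₗ[ℂ] X)) := by
  obtain ⟨d, hd, h⟩ := exists_hasDetOn (p := LinearMap.ker ((A : X →ₗ[ℂ] X) - LinearMap.id))
    (U := U) (fun x hx => by
      have hx : A x = x := by simpa [sub_eq_zero] using hx
      simp [hU, hx])
  obtain ⟨d', hd', h'⟩ := exists_hasDetOn (p := LinearMap.ker ((A : X →ₗ[ℂ] X) + LinearMap.id))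
    (U := U) (fun x hx => by
      have hx : A x = -x := by simpa [add_eq_zero_iff_eq_neg] using hx
      simp [hU, hx])
  have hc : d' / d ≠ 0 := div_ne_zero hd' hd
  refine ⟨d' / d, hc, _, mul_ne_zero (pow_ne_zero _ hc) hd', ?_, h'.smul _⟩
  convert h.smul (d' / d) using 1
  rw [hA.finrank_eq htr, pow_succ, mul_assoc, div_mul_cancel₀ _ hd]

end Normalization

section Weil

variable {C V X Y : Type*} [AddCommGroup C] [AddCommGroup V] [Finite C] [Finite V]
  [AddCommGroup X] [Module ℂ X] [AddCommGroup Y] [Module ℂ Y]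
  {φ : V → V → C} {lam : C → ℂ} {S : C × V → X ≃ₗ[ℂ] X}

/-- Every Schrödinger representation has an associated Weil representation. -/
theorem IsSchrodinger.exists_isWeilOn (hV : Odd (Nat.card V)) (hφ : IsBiadditive φ)
    (hmul : ∀ r s, lam (r + s) = lam r * lam s) (h0 : lam 0 = 1) (h : IsSchrodinger φ lam S) :
    ∃ W : (V ≃+ V) → X ≃ₗ[ℂ] X, IsWeilOn φ (IsIsometry φ) S W := by
  have hirr := h.2.1
  have := h.1.finiteDimensional hirr
  obtain ⟨A, hA, htr⟩ := h.exists_isParity_trace_eq_one hV hφ hmul h0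
  have hex (g : V ≃+ V) : ∃ U : X ≃ₗ[ℂ] X, IsIsometry φ g →
      (∀ p x, U (S p x) = S (hAct g p) (U x)) ∧ IsBalanced (A : X →ₗ[ℂ] X) U := by
    by_cases hg : IsIsometry φ g
    · obtain ⟨T, hT⟩ := h.2.2.2 g hg
      obtain ⟨c, hc, hbal⟩ := hA.exists_isBalanced htr (hA.commute htr hirr hT)
      exact ⟨T.trans (LinearEquiv.smulOfNeZero ℂ X c hc),
        fun _ => ⟨fun p x => by simp [hT], hbal⟩⟩
    · exact ⟨LinearEquiv.refl ℂ X, fun hg' => absurd hg' hg⟩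
  choose W hW using hex
  refine ⟨W, fun g g' hg hg' => ?_, fun g hg => (hW g hg).1⟩
  obtain ⟨hint, hbal⟩ := hW _ (hg.trans hg')
  obtain ⟨c, hc, hcx⟩ := hirr.exists_eq_smul (S' := fun p => S (hAct (g.trans g') p))
    (W g' * W g) (W (g.trans g'))
    (fun p x => by
      simp only [LinearEquiv.mul_apply, (hW g hg).1, (hW g' hg').1]
      rfl) hint
  have e : (W (g.trans g') : X →ₗ[ℂ] X) = c • ((W g' : X →ₗ[ℂ] X) ∘ₗ W g) :=
    LinearMap.ext hcx
  rw [e] at hbal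
  obtain rfl := IsBalanced.eq_one_of_smul hA htr hc ((hW g' hg').2.comp (hW g hg).2) hbal
  ext x
  simpa using hcx x

/-- The Weil representation is unique up to equivalence and multiplication by a character. -/
theorem IsWeilOn.exists_character (hV : Odd (Nat.card V)) (hφ : IsBiadditive φ)
    (hmul : ∀ r s, lam (r + s) = lam r * lam s) (h0 : lam 0 = 1) (h : IsSchrodinger φ lam S)
    {S' : C × V → Y ≃ₗ[ℂ] Y} (h' : IsSchrodinger φ lam S')
    {W : (V ≃+ V) → X ≃ₗ[ℂ] X} {W' : (V ≃+ V) → Y ≃ₗ[ℂ] Y}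
    (hW : IsWeilOn φ (IsIsometry φ) S W) (hW' : IsWeilOn φ (IsIsometry φ) S' W') :
    ∃ (χ : (V ≃+ V) → ℂ) (T : X ≃ₗ[ℂ] Y),
      (∀ g g', IsIsometry φ g → IsIsometry φ g' → χ (g.trans g') = χ g * χ g') ∧
      (∀ g, IsIsometry φ g → χ g ≠ 0) ∧
      (∀ g, IsIsometry φ g → ∀ x, W' g (T x) = χ g • T (W g x)) := by
  have := h.1.finiteDimensional h.2.1
  obtain ⟨T, hT⟩ := h.areEquivalent hV hφ hmul h0 h'
  have hex (g : V ≃+ V) : ∃ c : ℂ, IsIsometry φ g →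
      c ≠ 0 ∧ ∀ x, W' g (T x) = c • T (W g x) := by
    by_cases hg : IsIsometry φ g
    · obtain ⟨c, hc⟩ := h.2.1.exists_eq_smul (S' := fun p => S' (hAct g p))
        ((W g).trans T) (T.trans (W' g)) (fun p x => by simp [hW.2 g hg, hT])
        (fun p x => by simp [hW'.2 g hg, hT])
      exact ⟨c, fun _ => hc⟩
    · exact ⟨0, fun hg' => absurd hg' hg⟩
  choose χ hχ using hex
  refine ⟨χ, T, fun g g' hg hg' => ?_, fun g hg => (hχ g hg).1, fun g hg => (hχ g hg).2⟩
  obtain ⟨_, _⟩ := h.2.1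
  obtain ⟨x, hx⟩ := exists_ne (0 : X)
  have hne : T (W (g.trans g') x) ≠ 0 := by simpa using hx
  refine smul_left_injective ℂ hne ?_
  change χ (g.trans g') • T (W (g.trans g') x) = (χ g * χ g') • T (W (g.trans g') x)
  rw [← (hχ _ (hg.trans hg')).2, hW'.1 g g' hg hg', hW.1 g g' hg hg', LinearEquiv.mul_apply,
    LinearEquiv.mul_apply, (hχ g hg).2, map_smul, (hχ g' hg').2, smul_smul]

end Weil

/-- Theorem 2.4. For any Schrödinger representation `S` of `H(f)` of type `λ`
there is an associated Weil representation `W` of `G(f)`; moreover the Weil representation of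
type `λ` is unique up to equivalence and multiplication by a linear character of `G(f)`. -/
theorem statement2
    {R V : Type} [AddCommGroup R] [AddCommGroup V] [Finite R] [Finite V]
    (hR : Odd (Nat.card R)) (hV : Odd (Nat.card V))
    (f : V → V → R)
    (hf1 : ∀ u v w, f (u + v) w = f u w + f v w)
    (hf2 : ∀ u v w, f u (v + w) = f u v + f u w)
    (lam : R → ℂ) (hlam : ∀ r s, lam (r + s) = lam r * lam s) (hlam0 : lam 0 = 1) :
    (∀ (X : Type) (_ : AddCommGroup X) (_ : Module ℂ X) (S : R × V → X ≃ₗ[ℂ] X),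
        IsSchrodinger f lam S →
        ∃ W : (V ≃+ V) → X ≃ₗ[ℂ] X, IsWeilOn f (IsIsometry f) S W) ∧
    (∀ (X₁ : Type) (_ : AddCommGroup X₁) (_ : Module ℂ X₁)
        (S₁ : R × V → X₁ ≃ₗ[ℂ] X₁) (W₁ : (V ≃+ V) → X₁ ≃ₗ[ℂ] X₁)
        (X₂ : Type) (_ : AddCommGroup X₂) (_ : Module ℂ X₂)
        (S₂ : R × V → X₂ ≃ₗ[ℂ] X₂) (W₂ : (V ≃+ V) → X₂ ≃ₗ[ℂ] X₂),
        IsSchrodinger f lam S₁ → IsWeilOn f (IsIsometry f) S₁ W₁ →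
        IsSchrodinger f lam S₂ → IsWeilOn f (IsIsometry f) S₂ W₂ →
        ∃ (χ : (V ≃+ V) → ℂ) (T : X₁ ≃ₗ[ℂ] X₂),
          (∀ g g', IsIsometry f g → IsIsometry f g' → χ (g.trans g') = χ g * χ g') ∧
          (∀ g, IsIsometry f g → χ g ≠ 0) ∧
          (∀ g, IsIsometry f g → ∀ x, W₂ g (T x) = χ g • T (W₁ g x))) := by
  have hf : IsBiadditive f := ⟨hf1, hf2⟩
  exact ⟨fun X _ _ S h => h.exists_isWeilOn hV hf hlam hlam0,
    fun _ _ _ _ _ _ _ _ _ _ h₁ hW₁ h₂ hW₂ =>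
      hW₁.exists_character hV hf hlam hlam0 h₁ h₂ hW₂⟩

end Paper
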